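/- Let (A,R) be a minimal triangular pointed Hopf algebra with Drinfeld element u over an algebraically closed field k of characteristic 0, and set K := k[G(A)]. Then K admits a minimal triangular structure whose Drinfeld element u_K equals u; in particular u ∈ K and u² = 1. -/

import Mathlib

open TensorProduct

noncomputable section

universe u v w

namespace Paper

variable (k : Type*) [Field k]

section Basic

variable (A : Type*) [Ring A] [HopfAlgebra k A]

/-- `g` is a grouplike element of the Hopf algebra `A`. -/
def IsGrouplike (g : A) : Prop :=
  Coalgebra.counit (R := k) g = 1 ∧ Coalgebra.comul (R := k) g = g ⊗ₜ[k] g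

/-- `x` is a `g:h` skew primitive element of `A`, i.e. `Δ(x) = x ⊗ g + h ⊗ x`. -/
def IsSkewPrimitive (g h x : A) : Prop :=
  Coalgebra.comul (R := k) x = x ⊗ₜ[k] g + h ⊗ₜ[k] x

/-- The space `P_{g,h}(A)` of `g:h` skew primitives, as a submodule. -/
def skewPrimitives (g h : A) : Submodule k A :=
  LinearMap.ker (Coalgebra.comul (R := k) -
    ((TensorProduct.mk k A A).flip g + TensorProduct.mk k A A h))

end Basic

section Coalg

variable {M : Type*} [AddCommGroup M] [Module k M]

/-- `C` is a subcoalgebra with respect to the comultiplication `d`. -/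
def IsSubcoalgebraOf (d : M →ₗ[k] M ⊗[k] M) (C : Submodule k M) : Prop :=
  ∀ x ∈ C, d x ∈ LinearMap.range (TensorProduct.map C.subtype C.subtype)

/-- `C` is a simple subcoalgebra with respect to `d`. -/
def IsSimpleSubcoalgebraOf (d : M →ₗ[k] M ⊗[k] M) (C : Submodule k M) : Prop :=
  C ≠ ⊥ ∧ IsSubcoalgebraOf k d C ∧
    ∀ D : Submodule k M, IsSubcoalgebraOf k d D → D ≤ C → D = ⊥ ∨ D = C

/-- A coalgebra is pointed if all its simple subcoalgebras are `1`-dimensional. -/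
def IsPointedOf (d : M →ₗ[k] M ⊗[k] M) : Prop :=
  ∀ C : Submodule k M, IsSimpleSubcoalgebraOf k d C → Module.finrank k C = 1

/-- The coradical: the sum of all simple subcoalgebras. -/
def coradicalOf (d : M →ₗ[k] M ⊗[k] M) : Submodule k M :=
  sSup {C | IsSimpleSubcoalgebraOf k d C}

/-- The first term `A₁ = Δ⁻¹(A₀ ⊗ A + A ⊗ A₀)` of the coradical filtration. -/
def firstCoradicalTermOf (d : M →ₗ[k] M ⊗[k] M) : Submodule k M :=
  Submodule.comap d
    (LinearMap.range (TensorProduct.map (coradicalOf k d).subtype (LinearMap.id (M := M))) ⊔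
      LinearMap.range (TensorProduct.map (LinearMap.id (M := M)) (coradicalOf k d).subtype))

end Coalg

section Hopf

variable (A : Type*) [Ring A] [HopfAlgebra k A]

/-- A Hopf algebra is pointed if all its simple subcoalgebras are `1`-dimensional. -/
def IsPointed : Prop := IsPointedOf k (Coalgebra.comul (R := k) (A := A))

/-- A subalgebra `B` of `A` is a sub-Hopf-algebra if it is closed under
comultiplication and under the antipode. -/
def IsSubHopf (B : Subalgebra k A) : Prop :=
  (∀ x ∈ B, Coalgebra.comul (R := k) x ∈
      LinearMap.range (TensorProduct.map B.toSubmodule.subtype B.toSubmodule.subtype)) ∧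
  ∀ x ∈ B, HopfAlgebra.antipode (R := k) x ∈ B

/-- `r` belongs to `K ⊗ K ⊆ A ⊗ A` for a submodule `K` of `A`. -/
def MemTensorSquare (K : Submodule k A) (r : A ⊗[k] A) : Prop :=
  r ∈ LinearMap.range (TensorProduct.map K.subtype K.subtype)

/-- `(Δ ⊗ id)(r) = r₁₃ r₂₃`. -/
def Hexagon₁ (r : A ⊗[k] A) : Prop :=
  Algebra.TensorProduct.map (Bialgebra.comulAlgHom k A) (AlgHom.id k A) r =
    Algebra.TensorProduct.map (Algebra.TensorProduct.includeLeft (R := k) (S := k)) (AlgHom.id k A) r *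
      Algebra.TensorProduct.map (Algebra.TensorProduct.includeRight (R := k)) (AlgHom.id k A) r

/-- `(id ⊗ Δ)(r) = r₁₃ r₁₂`. -/
def Hexagon₂ (r : A ⊗[k] A) : Prop :=
  Algebra.TensorProduct.map (AlgHom.id k A) (Bialgebra.comulAlgHom k A) r =
    Algebra.TensorProduct.map (AlgHom.id k A) (Algebra.TensorProduct.includeRight (R := k)) r *
      Algebra.TensorProduct.map (AlgHom.id k A) (Algebra.TensorProduct.includeLeft (R := k) (S := k)) r

/-- The Drinfeld element `u = Σ S(R⁽²⁾) R⁽¹⁾` associated to an element `r ∈ A ⊗ A`. -/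
def drinfeldOf (r : A ⊗[k] A) : A :=
  LinearMap.mul' k A
    ((TensorProduct.map (HopfAlgebra.antipode (R := k)) LinearMap.id)
      ((TensorProduct.comm k A A) r))

/-- A quasitriangular structure on the Hopf algebra `A`. -/
structure QuasiTriangular where
  /-- the R-matrix -/
  R : A ⊗[k] A
  isUnit : IsUnit R
  intertwine : ∀ a : A,
    (TensorProduct.comm k A A) (Coalgebra.comul (R := k) a) * R = R * Coalgebra.comul (R := k) a
  hexagon₁ : Hexagon₁ k A R
  hexagon₂ : Hexagon₂ k A R

variable {A}

/-- A quasitriangular Hopf algebra is triangular if `R R₂₁ = 1 ⊗ 1`. -/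
def QuasiTriangular.IsTriangular (Q : QuasiTriangular k A) : Prop :=
  Q.R * (TensorProduct.comm k A A) Q.R = 1

/-- `(A,R)` is minimal if no proper sub-Hopf-algebra contains the components of `R`. -/
def QuasiTriangular.IsMinimal (Q : QuasiTriangular k A) : Prop :=
  ∀ B : Subalgebra k A, IsSubHopf k A B → MemTensorSquare k A B.toSubmodule Q.R → B = ⊤

/-- The Drinfeld element of a quasitriangular Hopf algebra. -/
def QuasiTriangular.drinfeld (Q : QuasiTriangular k A) : A := drinfeldOf k A Q.R

/-- The map `f_R : A* → A`, `p ↦ (p ⊗ I)(R)`. -/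
def fR (Q : QuasiTriangular k A) : Module.Dual k A →ₗ[k] A :=
  TensorProduct.lift
    (LinearMap.mk₂ k (fun a b => (Module.Dual.eval k A a).smulRight b)
      (fun a a' b => by ext p; simp [add_smul])
      (fun c a b => by ext p; simp [smul_smul])
      (fun a b b' => by ext p; simp [smul_add])
      (fun c a b => by ext p; simp [smul_comm (p a) c b])) Q.R

/-- Radford's coinvariants `B = {x ∈ A | (I ⊗ π)Δ(x) = x ⊗ 1}` of a projection `π`. -/
def coinvariants (π : A →ₗ[k] A) : Submodule k A :=
  LinearMap.ker
    ((TensorProduct.map LinearMap.id π) ∘ₗ Coalgebra.comul (R := k) -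
      (TensorProduct.mk k A A).flip 1)

end Hopf


section Contraction

variable {k} {M N : Type*} [AddCommGroup M] [Module k M] [AddCommGroup N] [Module k N]

/-- Two tensors agree if all their contractions in the right factor agree. -/
lemma tensor_ext_right {x y : M ⊗[k] N}
    (h : ∀ p : Module.Dual k N,
      TensorProduct.rid k M (p.lTensor M x) = TensorProduct.rid k M (p.lTensor M y)) : x = y := by
  classical
  apply (TensorProduct.equivFinsuppOfBasisRight (M := M) (Module.Basis.ofVectorSpace k N)).injective
  ext i
  simp only [TensorProduct.equivFinsuppOfBasisRight_apply]
  exact h _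

/-- Two tensors agree if all their contractions in the left factor agree. -/
lemma tensor_ext_left {x y : M ⊗[k] N}
    (h : ∀ p : Module.Dual k M,
      TensorProduct.lid k N (p.rTensor N x) = TensorProduct.lid k N (p.rTensor N y)) : x = y := by
  classical
  apply (TensorProduct.equivFinsuppOfBasisLeft (N := N) (Module.Basis.ofVectorSpace k M)).injective
  ext i
  simp only [TensorProduct.equivFinsuppOfBasisLeft_apply]
  exact h _

lemma rid_lTensor_rTensor (e : M →ₗ[k] M) (p : Module.Dual k N) (x : M ⊗[k] N) :
    TensorProduct.rid k M (p.lTensor M (e.rTensor N x)) =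
      e (TensorProduct.rid k M (p.lTensor M x)) := by
  induction x with
  | zero => simp
  | tmul x y => simp
  | add x y hx hy => simp [hx, hy]

lemma lid_rTensor_lTensor (e : N →ₗ[k] N) (p : Module.Dual k M) (x : M ⊗[k] N) :
    TensorProduct.lid k N (p.rTensor N (e.lTensor M x)) =
      e (TensorProduct.lid k N (p.rTensor N x)) := by
  induction x with
  | zero => simp
  | tmul x y => simp
  | add x y hx hy => simp [hx, hy]

/-- A projection onto a subspace, as an endomorphism of the ambient space. -/
lemma exists_projection (V : Submodule k M) :
    ∃ P : M →ₗ[k] V, ∀ x ∈ V, V.subtype (P x) = x := by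
  obtain ⟨P, hP⟩ := V.subtype.exists_leftInverse_of_injective V.ker_subtype
  refine ⟨P, fun x hx => ?_⟩
  have := LinearMap.congr_fun hP ⟨x, hx⟩
  simpa using congrArg Subtype.val this

/-- A tensor lies in `V ⊗ W` as soon as all its contractions lie in `V` and in `W`. -/
lemma mem_range_map_of_contractions (V : Submodule k M) (W : Submodule k N) (x : M ⊗[k] N)
    (hV : ∀ p : Module.Dual k N, TensorProduct.rid k M (p.lTensor M x) ∈ V)
    (hW : ∀ p : Module.Dual k M, TensorProduct.lid k N (p.rTensor N x) ∈ W) :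
    x ∈ LinearMap.range (TensorProduct.map V.subtype W.subtype) := by
  obtain ⟨P, hP⟩ := exists_projection V
  obtain ⟨P', hP'⟩ := exists_projection W
  have h1 : (V.subtype ∘ₗ P).rTensor N x = x := by
    refine tensor_ext_right fun p => ?_
    rw [rid_lTensor_rTensor]
    exact hP _ (hV p)
  have h2 : (W.subtype ∘ₗ P').lTensor M x = x := by
    refine tensor_ext_left fun p => ?_
    rw [lid_rTensor_lTensor]
    exact hP' _ (hW p)
  refine ⟨TensorProduct.map P P' x, ?_⟩
  rw [← LinearMap.comp_apply, ← TensorProduct.map_comp]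
  conv_rhs => rw [← h1, ← h2]
  rw [← LinearMap.comp_apply, LinearMap.rTensor_comp_lTensor]

lemma rid_lTensor_mem {V : Submodule k M} {W : Submodule k N} {x : M ⊗[k] N}
    (hx : x ∈ LinearMap.range (TensorProduct.map V.subtype W.subtype)) (p : Module.Dual k N) :
    TensorProduct.rid k M (p.lTensor M x) ∈ V := by
  obtain ⟨y, rfl⟩ := hx
  induction y with
  | zero => simp
  | tmul x y => simpa using V.smul_mem _ x.2
  | add x y hx hy => simpa using V.add_mem hx hy

lemma lid_rTensor_mem {V : Submodule k M} {W : Submodule k N} {x : M ⊗[k] N}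
    (hx : x ∈ LinearMap.range (TensorProduct.map V.subtype W.subtype)) (p : Module.Dual k M) :
    TensorProduct.lid k N (p.rTensor N x) ∈ W := by
  obtain ⟨y, rfl⟩ := hx
  induction y with
  | zero => simp
  | tmul x y => simpa using W.smul_mem _ y.2
  | add x y hx hy => simpa using W.add_mem hx hy

end Contraction

section Family

variable {k} {A : Type*} [Ring A] [HopfAlgebra k A] {ι : Type*} [Fintype ι]

/-- The tensor `∑ aᵢ ⊗ bᵢ` satisfies both hexagon identities and is inverse to its flip. -/
structure IsTriangularFamily (k : Type*) [Field k] {A : Type*} [Ring A] [HopfAlgebra k A]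
    {ι : Type*} [Fintype ι] (a b : ι → A) : Prop where
  comul_left : ∑ i, Coalgebra.comul (R := k) (a i) ⊗ₜ[k] b i =
    ∑ i, ∑ j, (a i ⊗ₜ[k] a j) ⊗ₜ[k] (b i * b j)
  comul_right : ∑ i, a i ⊗ₜ[k] Coalgebra.comul (R := k) (b i) =
    ∑ i, ∑ j, (a i * a j) ⊗ₜ[k] (b j ⊗ₜ[k] b i)
  mul_swap : ∑ i, ∑ j, (a i * b j) ⊗ₜ[k] (b i * a j) = 1

lemma isTriangularFamily_iff (a b : ι → A) :
    IsTriangularFamily k a b ↔ Hexagon₁ k A (∑ i, a i ⊗ₜ[k] b i) ∧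
      Hexagon₂ k A (∑ i, a i ⊗ₜ[k] b i) ∧
      (∑ i, a i ⊗ₜ[k] b i) * TensorProduct.comm k A A (∑ i, a i ⊗ₜ[k] b i) = 1 := by
  have e1 : Hexagon₁ k A (∑ i, a i ⊗ₜ[k] b i) ↔
      ∑ i, Coalgebra.comul (R := k) (a i) ⊗ₜ[k] b i =
        ∑ i, ∑ j, (a i ⊗ₜ[k] a j) ⊗ₜ[k] (b i * b j) := by
    simp [Hexagon₁, map_sum, Finset.sum_mul_sum]
  have e2 : Hexagon₂ k A (∑ i, a i ⊗ₜ[k] b i) ↔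
      ∑ i, a i ⊗ₜ[k] Coalgebra.comul (R := k) (b i) =
        ∑ i, ∑ j, (a i * a j) ⊗ₜ[k] (b j ⊗ₜ[k] b i) := by
    simp [Hexagon₂, map_sum, Finset.sum_mul_sum]
  have e3 : (∑ i, a i ⊗ₜ[k] b i) * TensorProduct.comm k A A (∑ i, a i ⊗ₜ[k] b i) = 1 ↔
      ∑ i, ∑ j, (a i * b j) ⊗ₜ[k] (b i * a j) = 1 := by
    simp [map_sum, Finset.sum_mul_sum]
  rw [e1, e2, e3]
  exact ⟨fun h => ⟨h.1, h.2, h.3⟩, fun h => ⟨h.1, h.2.1, h.2.2⟩⟩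

/-- `S²(x) u = u x` for the element `u = ∑ S(bᵢ) aᵢ`. -/
lemma antipode_antipode_mul_drinfeld (a b : ι → A)
    (hint : ∀ x : A, TensorProduct.comm k A A (Coalgebra.comul (R := k) x) *
      (∑ i, a i ⊗ₜ[k] b i) = (∑ i, a i ⊗ₜ[k] b i) * Coalgebra.comul (R := k) x) (x : A) :
    HopfAlgebra.antipode k (HopfAlgebra.antipode k x) *
      (∑ i, HopfAlgebra.antipode k (b i) * a i) =
      (∑ i, HopfAlgebra.antipode k (b i) * a i) * x := by
  set u : A := ∑ i, HopfAlgebra.antipode k (b i) * a i with hu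
  let S : A →ₗ[k] A := HopfAlgebra.antipode k
  let θ : A ⊗[k] A →ₗ[k] A :=
    LinearMap.mul' k A ∘ₗ TensorProduct.map S LinearMap.id ∘ₗ (TensorProduct.comm k A A).toLinearMap
  let D : A ⊗[k] A →ₗ[k] A := LinearMap.mul' k A ∘ₗ
    TensorProduct.map (LinearMap.mulRight k u ∘ₗ S) LinearMap.id ∘ₗ
      (TensorProduct.comm k A A).toLinearMap
  have hθ1 (t : A ⊗[k] A) : θ ((∑ i, a i ⊗ₜ[k] b i) * t) = D t := by
    induction t with
    | zero => simp
    | tmul y z =>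
      simp [θ, D, S, hu, Finset.sum_mul, Finset.mul_sum, HopfAlgebra.antipode_mul_antidistrib,
        mul_assoc]
    | add t t' ht ht' => simp only [mul_add, map_add, ht, ht']
  have hθ2 (t : A ⊗[k] A) : θ (TensorProduct.comm k A A t * (∑ i, a i ⊗ₜ[k] b i)) =
      ∑ i, S (b i) * (LinearMap.mul' k A (S.rTensor A t)) * a i := by
    induction t with
    | zero => simp
    | tmul y z =>
      simp [θ, S, Finset.mul_sum, HopfAlgebra.antipode_mul_antidistrib, mul_assoc]
    | add t t' ht ht' =>
      simp only [add_mul, mul_add, map_add, ht, ht', Finset.sum_add_distrib]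
  have hD (y : A) : D (Coalgebra.comul (R := k) y) = Coalgebra.counit (R := k) y • u := by
    rw [← hθ1, ← hint, hθ2, HopfAlgebra.mul_antipode_rTensor_comul_apply]
    simp [S, hu, Algebra.algebraMap_eq_smul_one, Finset.smul_sum]
  let L : (A ⊗[k] A) ⊗[k] A →ₗ[k] A := LinearMap.mul' k A ∘ₗ TensorProduct.map (S ∘ₗ S) D ∘ₗ
    (TensorProduct.comm k (A ⊗[k] A) A).toLinearMap
  have hL1 (t : A ⊗[k] A) : L ((Coalgebra.comul (R := k)).rTensor A t) =
      S (S (TensorProduct.lid k A ((Coalgebra.counit (R := k)).rTensor A t))) * u := by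
    induction t with
    | zero => simp
    | tmul y z => simp [L, hD]
    | add t t' ht ht' => simp only [add_mul, map_add, ht, ht']
  have hL2 (y : A) (s : A ⊗[k] A) : L ((TensorProduct.assoc k A A A).symm (y ⊗ₜ[k] s)) =
      S (LinearMap.mul' k A (S.lTensor A s)) * (u * y) := by
    induction s with
    | zero => simp
    | tmul z w => simp [L, D, S, HopfAlgebra.antipode_mul_antidistrib, mul_assoc]
    | add t t' ht ht' => simp only [TensorProduct.tmul_add, add_mul, map_add, ht, ht']
  have hL3 (t : A ⊗[k] A) : L ((TensorProduct.assoc k A A A).symm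
      ((Coalgebra.comul (R := k)).lTensor A t)) =
      u * TensorProduct.rid k A ((Coalgebra.counit (R := k)).lTensor A t) := by
    induction t with
    | zero => simp
    | tmul y z =>
      rw [LinearMap.lTensor_tmul, hL2, HopfAlgebra.mul_antipode_lTensor_comul_apply]
      simp [S, Algebra.algebraMap_eq_smul_one, HopfAlgebra.antipode_one]
    | add t t' ht ht' => simp only [mul_add, map_add, ht, ht']
  have e1 := hL1 (Coalgebra.comul (R := k) x)
  have e2 := hL3 (Coalgebra.comul (R := k) x)
  rw [Coalgebra.coassoc_symm_apply] at e2
  rw [e1] at e2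
  simpa [S] using e2

namespace IsTriangularFamily

variable {a b : ι → A} (h : IsTriangularFamily k a b)
include h

lemma tensor_mul_swap : (∑ i, a i ⊗ₜ[k] b i) * ∑ i, b i ⊗ₜ[k] a i = 1 := by
  simpa [Finset.sum_mul_sum] using h.mul_swap

lemma swap_mul_tensor : (∑ i, b i ⊗ₜ[k] a i) * ∑ i, a i ⊗ₜ[k] b i = 1 := by
  have := congrArg (Algebra.TensorProduct.comm k A A) h.tensor_mul_swap
  simpa [map_sum, map_mul] using this

lemma sum_counit_smul_right : ∑ i, Coalgebra.counit (R := k) (a i) • b i = 1 := by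
  have h1 := congrArg (TensorProduct.map
    ((TensorProduct.lid k A).toLinearMap ∘ₗ (Coalgebra.counit (R := k)).rTensor A)
    LinearMap.id) h.comul_left
  simp only [map_sum, TensorProduct.map_tmul, LinearMap.comp_apply, LinearEquiv.coe_coe,
    Coalgebra.rTensor_counit_comul, TensorProduct.lid_tmul, LinearMap.id_apply, one_smul,
    LinearMap.rTensor_tmul] at h1
  have h2 : ∑ i, a i ⊗ₜ[k] b i = ((1 : A) ⊗ₜ[k] ∑ i, Coalgebra.counit (R := k) (a i) • b i) *
      ∑ i, a i ⊗ₜ[k] b i := by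
    conv_lhs => rw [h1]
    simp only [TensorProduct.tmul_sum, Finset.sum_mul_sum, Algebra.TensorProduct.tmul_mul_tmul,
      one_mul, smul_mul_assoc, TensorProduct.tmul_smul, TensorProduct.smul_tmul']
  have h3 := congrArg (· * ∑ i, b i ⊗ₜ[k] a i) h2
  simp only [mul_assoc, h.tensor_mul_swap, mul_one] at h3
  have h4 := congrArg (TensorProduct.lid k A ∘ (Coalgebra.counit (R := k)).rTensor A) h3
  simpa [Algebra.TensorProduct.one_def] using h4.symm

lemma sum_counit_smul_left : ∑ i, Coalgebra.counit (R := k) (b i) • a i = 1 := by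
  have h1 := congrArg (TensorProduct.map LinearMap.id
    ((TensorProduct.lid k A).toLinearMap ∘ₗ (Coalgebra.counit (R := k)).rTensor A)) h.comul_right
  simp only [map_sum, TensorProduct.map_tmul, LinearMap.comp_apply, LinearEquiv.coe_coe,
    Coalgebra.rTensor_counit_comul, TensorProduct.lid_tmul, LinearMap.id_apply, one_smul,
    LinearMap.rTensor_tmul] at h1
  have h2 : ∑ i, a i ⊗ₜ[k] b i = (∑ i, a i ⊗ₜ[k] b i) *
      ((∑ i, Coalgebra.counit (R := k) (b i) • a i) ⊗ₜ[k] (1 : A)) := by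
    conv_lhs => rw [h1]
    simp only [TensorProduct.sum_tmul, Finset.sum_mul_sum, Algebra.TensorProduct.tmul_mul_tmul,
      mul_one, mul_smul_comm, TensorProduct.tmul_smul, TensorProduct.smul_tmul']
  have h3 := congrArg ((∑ i, b i ⊗ₜ[k] a i) * ·) h2
  simp only [← mul_assoc, h.swap_mul_tensor, one_mul] at h3
  have h4 := congrArg (TensorProduct.rid k A ∘ (Coalgebra.counit (R := k)).lTensor A) h3
  simpa [Algebra.TensorProduct.one_def] using h4.symm

/-- `(S ⊗ id)(R) = R₂₁`. -/
lemma antipode_left : ∑ i, HopfAlgebra.antipode k (a i) ⊗ₜ[k] b i = ∑ i, b i ⊗ₜ[k] a i := by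
  have h1 := congrArg (TensorProduct.map
    (LinearMap.mul' k A ∘ₗ (HopfAlgebra.antipode k).rTensor A) LinearMap.id) h.comul_left
  simp only [map_sum, TensorProduct.map_tmul, LinearMap.comp_apply,
    HopfAlgebra.mul_antipode_rTensor_comul_apply, LinearMap.id_apply,
    LinearMap.rTensor_tmul, LinearMap.mul'_apply] at h1
  have h2 : (∑ i, HopfAlgebra.antipode k (a i) ⊗ₜ[k] b i) * ∑ i, a i ⊗ₜ[k] b i = 1 := by
    simp only [Finset.sum_mul_sum, Algebra.TensorProduct.tmul_mul_tmul]
    rw [← h1]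
    simp only [Algebra.algebraMap_eq_smul_one, TensorProduct.smul_tmul, ← TensorProduct.tmul_sum,
      h.sum_counit_smul_right, Algebra.TensorProduct.one_def]
  have h3 := congrArg (· * ∑ i, b i ⊗ₜ[k] a i) h2
  simpa only [mul_assoc, h.tensor_mul_swap, mul_one, one_mul] using h3

/-- `(S ⊗ S)(R) = R`. -/
lemma antipode_antipode : ∑ i, HopfAlgebra.antipode k (a i) ⊗ₜ[k] HopfAlgebra.antipode k (b i) =
    ∑ i, a i ⊗ₜ[k] b i := by
  have h1 := congrArg (TensorProduct.map LinearMap.id (HopfAlgebra.antipode k)) h.antipode_left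
  have h2 := congrArg (TensorProduct.comm k A A) h.antipode_left
  simp only [map_sum, TensorProduct.map_tmul, TensorProduct.comm_tmul, LinearMap.id_apply] at h1 h2
  rw [h1, h2]

/-- `u = ∑ S²(aᵢ) bᵢ`. -/
lemma drinfeldOf_eq : drinfeldOf k A (∑ i, a i ⊗ₜ[k] b i) =
    ∑ i, HopfAlgebra.antipode k (HopfAlgebra.antipode k (a i)) * b i := by
  have h1 := congrArg (TensorProduct.map (HopfAlgebra.antipode k) LinearMap.id) h.antipode_left
  simp only [map_sum, TensorProduct.map_tmul, LinearMap.id_apply] at h1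
  have h2 := congrArg (LinearMap.mul' k A) h1
  simp only [map_sum, LinearMap.mul'_apply] at h2
  rw [h2]
  simp [drinfeldOf, map_sum]

/-- `S` is an anticoalgebra map on the left components of the family. -/
lemma comul_antipode_tmul :
    ∑ i, Coalgebra.comul (R := k) (HopfAlgebra.antipode k (a i)) ⊗ₜ[k] b i =
      ∑ i, TensorProduct.comm k A A (TensorProduct.map (HopfAlgebra.antipode k)
        (HopfAlgebra.antipode k) (Coalgebra.comul (R := k) (a i))) ⊗ₜ[k] b i := by
  have h1 := congrArg (TensorProduct.map (Coalgebra.comul (R := k)) LinearMap.id) h.antipode_left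
  have h2 := congrArg (TensorProduct.comm k A (A ⊗[k] A)) h.comul_right
  have h3 := congrArg (TensorProduct.map ((TensorProduct.comm k A A).toLinearMap ∘ₗ
    TensorProduct.map (HopfAlgebra.antipode k) (HopfAlgebra.antipode k)) LinearMap.id) h.comul_left
  have h4 := congrArg (fun t => (TensorProduct.map (TensorProduct.comm k A A).toLinearMap
    (LinearMap.mul' k A) ∘ₗ (TensorProduct.tensorTensorTensorComm k A A A A).toLinearMap)
      (t ⊗ₜ[k] t)) h.antipode_left
  simp only [map_sum, TensorProduct.map_tmul, LinearMap.comp_apply, LinearEquiv.coe_coe,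
    LinearMap.id_apply, TensorProduct.comm_tmul, TensorProduct.sum_tmul, TensorProduct.tmul_sum,
    TensorProduct.tensorTensorTensorComm_tmul, LinearMap.mul'_apply] at h1 h2 h3 h4
  rw [h1, h2, h3, Finset.sum_comm, ← h4, Finset.sum_comm]

/-- The Drinfeld element of a triangular Hopf algebra satisfies `Δ(u) = u ⊗ u`. -/
lemma comul_drinfeld
    (hint : ∀ x : A, TensorProduct.comm k A A (Coalgebra.comul (R := k) x) *
      (∑ i, a i ⊗ₜ[k] b i) = (∑ i, a i ⊗ₜ[k] b i) * Coalgebra.comul (R := k) x)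
    (hS : ∀ x : A, Coalgebra.comul (R := k) (HopfAlgebra.antipode k x) =
      TensorProduct.comm k A A (TensorProduct.map (HopfAlgebra.antipode k)
        (HopfAlgebra.antipode k) (Coalgebra.comul (R := k) x))) :
    Coalgebra.comul (R := k) (∑ i, HopfAlgebra.antipode k (b i) * a i) =
      (∑ i, HopfAlgebra.antipode k (b i) * a i) ⊗ₜ[k]
        (∑ i, HopfAlgebra.antipode k (b i) * a i) := by
  have hconj := antipode_antipode_mul_drinfeld a b hint
  set u : A := ∑ i, HopfAlgebra.antipode k (b i) * a i with hu
  let S : A →ₗ[k] A := HopfAlgebra.antipode k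
  have hSmul (x y : A) : S (x * y) = S y * S x := HopfAlgebra.antipode_mul_antidistrib x y
  have hB : Coalgebra.comul (R := k) u = ∑ i, ∑ j, (S (b i) ⊗ₜ[k] S (b j)) *
      (Coalgebra.comul (R := k) (a i) * Coalgebra.comul (R := k) (a j)) := by
    have := congrArg (LinearMap.mul' k (A ⊗[k] A) ∘ₗ
      (TensorProduct.comm k (A ⊗[k] A) (A ⊗[k] A)).toLinearMap ∘ₗ
      TensorProduct.map (Coalgebra.comul (R := k))
        ((TensorProduct.comm k A A).toLinearMap ∘ₗ TensorProduct.map S S)) h.comul_right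
    simp only [map_sum, LinearMap.comp_apply, LinearEquiv.coe_coe, TensorProduct.map_tmul,
      TensorProduct.comm_tmul, LinearMap.mul'_apply, Bialgebra.comul_mul] at this
    rw [← this, hu, map_sum]
    exact Finset.sum_congr rfl fun i _ => by rw [Bialgebra.comul_mul, hS]
  have hE : ∑ i, (S (b i) ⊗ₜ[k] (1 : A)) * Coalgebra.comul (R := k) (a i) =
      ∑ j, (S (b j) * u) ⊗ₜ[k] a j := by
    have := congrArg (LinearMap.mul' k (A ⊗[k] A) ∘ₗ
      (TensorProduct.comm k (A ⊗[k] A) (A ⊗[k] A)).toLinearMap ∘ₗ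
      TensorProduct.map LinearMap.id ((TensorProduct.mk k A A).flip 1 ∘ₗ S)) h.comul_left
    simp only [map_sum, LinearMap.comp_apply, LinearEquiv.coe_coe, TensorProduct.map_tmul,
      TensorProduct.comm_tmul, LinearMap.mul'_apply, LinearMap.id_apply, LinearMap.flip_apply,
      TensorProduct.mk_apply, Algebra.TensorProduct.tmul_mul_tmul, one_mul, hSmul] at this
    rw [this, Finset.sum_comm]
    refine Finset.sum_congr rfl fun j _ => ?_
    rw [hu, Finset.mul_sum, TensorProduct.sum_tmul]
    simp [mul_assoc, S]
  set E : A ⊗[k] A := ∑ j, (S (b j) * u) ⊗ₜ[k] a j with hEdef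
  have hC : Coalgebra.comul (R := k) u =
      ∑ j, ((1 : A) ⊗ₜ[k] S (b j)) * E * Coalgebra.comul (R := k) (a j) := by
    rw [hB, Finset.sum_comm]
    refine Finset.sum_congr rfl fun j _ => ?_
    rw [← hE, Finset.mul_sum, Finset.sum_mul]
    refine Finset.sum_congr rfl fun i _ => ?_
    rw [← mul_assoc, ← mul_assoc, Algebra.TensorProduct.tmul_mul_tmul, one_mul, mul_one]
  have hD : Coalgebra.comul (R := k) u = ∑ l, ((1 : A) ⊗ₜ[k] S (b l)) *
      (∑ i, ((1 : A) ⊗ₜ[k] S (b i)) * E * (a i ⊗ₜ[k] (1 : A))) * ((1 : A) ⊗ₜ[k] a l) := by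
    have := congrArg (LinearMap.mul' k (A ⊗[k] A) ∘ₗ
      (TensorProduct.comm k (A ⊗[k] A) (A ⊗[k] A)).toLinearMap ∘ₗ
      TensorProduct.map LinearMap.id
        (LinearMap.mulRight k E ∘ₗ TensorProduct.mk k A A 1 ∘ₗ S)) h.comul_left
    simp only [map_sum, LinearMap.comp_apply, LinearEquiv.coe_coe, TensorProduct.map_tmul,
      TensorProduct.comm_tmul, LinearMap.mul'_apply, LinearMap.id_apply, LinearMap.mulRight_apply,
      TensorProduct.mk_apply, hSmul] at this
    rw [hC, this, Finset.sum_comm]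
    refine Finset.sum_congr rfl fun l _ => ?_
    rw [Finset.mul_sum, Finset.sum_mul]
    refine Finset.sum_congr rfl fun i _ => ?_
    rw [show (1 : A) ⊗ₜ[k] (S (b l) * S (b i)) = (1 ⊗ₜ[k] S (b l)) * (1 ⊗ₜ[k] S (b i)) by simp,
      show a i ⊗ₜ[k] a l = (a i ⊗ₜ[k] (1 : A)) * (1 ⊗ₜ[k] a l) by simp]
    simp only [mul_assoc]
  have hF : ∑ i, ((1 : A) ⊗ₜ[k] S (b i)) * E * (a i ⊗ₜ[k] (1 : A)) = u ⊗ₜ[k] (1 : A) := by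
    have e1 : ∑ i, ((1 : A) ⊗ₜ[k] S (b i)) * E * (a i ⊗ₜ[k] (1 : A)) =
        (∑ j, ∑ i, S (S (a i) * b j) ⊗ₜ[k] (S (b i) * a j)) * (u ⊗ₜ[k] (1 : A)) := by
      rw [Finset.sum_comm, hEdef]
      simp only [Finset.mul_sum, Finset.sum_mul, Algebra.TensorProduct.tmul_mul_tmul, one_mul,
        mul_one, hSmul, mul_assoc]
      refine Finset.sum_congr rfl fun i _ => Finset.sum_congr rfl fun j _ => ?_
      rw [← hconj]
    have e2 : ∑ j, ∑ i, S (S (a i) * b j) ⊗ₜ[k] (S (b i) * a j) =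
        ∑ j, ∑ i, S (a i * b j) ⊗ₜ[k] (b i * a j) := by
      refine Finset.sum_congr rfl fun j _ => ?_
      have := congrArg (TensorProduct.map (S ∘ₗ LinearMap.mulRight k (b j))
        (LinearMap.mulRight k (a j))) h.antipode_antipode
      simpa [map_sum] using this
    have e3 := congrArg (S.rTensor A) h.mul_swap
    simp only [map_sum, LinearMap.rTensor_tmul, Algebra.TensorProduct.one_def] at e3
    rw [e1, e2, Finset.sum_comm, e3]
    simp [S, HopfAlgebra.antipode_one]
  rw [hD, hF]
  simp only [Algebra.TensorProduct.tmul_mul_tmul, one_mul, mul_one, ← TensorProduct.tmul_sum]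
  rfl

end IsTriangularFamily

/-- The linear map `p ↦ ∑ p(bᵢ) aᵢ`. -/
def slice (a b : ι → A) : Module.Dual k A →ₗ[k] A :=
  ∑ i, (Module.Dual.eval k A (b i)).smulRight (a i)

lemma slice_apply (a b : ι → A) (p : Module.Dual k A) : slice a b p = ∑ i, p (b i) • a i := by
  simp [slice]

lemma apply_slice (a b : ι → A) (p q : Module.Dual k A) : q (slice a b p) = p (slice b a q) := by
  simp [slice_apply, mul_comm]

instance finite_range_slice (a b : ι → A) :
    Module.Finite k (LinearMap.range (slice (k := k) a b)) := by
  have hle : LinearMap.range (slice (k := k) a b) ≤ Submodule.span k (Set.range a) := by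
    rintro _ ⟨p, rfl⟩
    rw [slice_apply]
    exact Submodule.sum_mem _ fun i _ =>
      Submodule.smul_mem _ _ (Submodule.subset_span ⟨i, rfl⟩)
  have := Module.Finite.span_of_finite k (Set.finite_range a)
  exact Submodule.finiteDimensional_of_le hle

namespace IsTriangularFamily

variable {a b : ι → A} (h : IsTriangularFamily k a b)
include h

lemma slice_counit : slice a b (Coalgebra.counit (R := k)) = 1 := by
  rw [slice_apply, h.sum_counit_smul_left]

lemma slice_counit' : slice b a (Coalgebra.counit (R := k)) = 1 := by
  rw [slice_apply, h.sum_counit_smul_right]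

lemma slice_mul_slice (p q : Module.Dual k A) : slice a b p * slice a b q =
    slice a b (LinearMap.mul' k k ∘ₗ TensorProduct.map q p ∘ₗ Coalgebra.comul (R := k)) := by
  have := congrArg (TensorProduct.rid k A ∘
    (LinearMap.mul' k k ∘ₗ TensorProduct.map q p).lTensor A) h.comul_right
  simp only [Function.comp_apply, map_sum, LinearMap.lTensor_tmul, TensorProduct.rid_tmul,
    LinearMap.comp_apply, TensorProduct.map_tmul, LinearMap.mul'_apply] at this
  simp only [slice_apply, LinearMap.comp_apply]
  rw [this, Finset.sum_mul_sum]
  refine Finset.sum_congr rfl fun i _ => Finset.sum_congr rfl fun j _ => ?_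
  rw [smul_mul_smul_comm, mul_comm (p _)]

lemma slice_mul_slice' (p q : Module.Dual k A) : slice b a p * slice b a q =
    slice b a (LinearMap.mul' k k ∘ₗ TensorProduct.map p q ∘ₗ Coalgebra.comul (R := k)) := by
  have := congrArg (TensorProduct.lid k A ∘
    (LinearMap.mul' k k ∘ₗ TensorProduct.map p q).rTensor A) h.comul_left
  simp only [Function.comp_apply, map_sum, LinearMap.rTensor_tmul, TensorProduct.lid_tmul,
    LinearMap.comp_apply, TensorProduct.map_tmul, LinearMap.mul'_apply] at this
  simp only [slice_apply, LinearMap.comp_apply]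
  rw [this, Finset.sum_mul_sum]
  refine Finset.sum_congr rfl fun i _ => Finset.sum_congr rfl fun j _ => ?_
  rw [smul_mul_smul_comm]

lemma comul_slice (p : Module.Dual k A) : Coalgebra.comul (R := k) (slice a b p) =
    ∑ i, ∑ j, p (b i * b j) • a i ⊗ₜ[k] a j := by
  have := congrArg (TensorProduct.rid k (A ⊗[k] A) ∘ p.lTensor (A ⊗[k] A)) h.comul_left
  simpa [slice_apply, map_sum] using this

lemma comul_slice' (p : Module.Dual k A) : Coalgebra.comul (R := k) (slice b a p) =
    ∑ i, ∑ j, p (a i * a j) • b j ⊗ₜ[k] b i := by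
  have := congrArg (TensorProduct.lid k (A ⊗[k] A) ∘ p.rTensor (A ⊗[k] A)) h.comul_right
  simpa [slice_apply, map_sum] using this

lemma slice_eq_antipode_slice (p : Module.Dual k A) :
    slice b a p = HopfAlgebra.antipode k (slice a b p) := by
  have := congrArg (TensorProduct.rid k A ∘ p.lTensor A) h.antipode_left
  simpa [slice_apply, map_sum] using this.symm

lemma slice_eq_slice_comp_antipode (p : Module.Dual k A) :
    slice a b p = slice b a (p ∘ₗ HopfAlgebra.antipode k) := by
  have := congrArg (TensorProduct.lid k A ∘ p.rTensor A) h.antipode_left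
  simpa [slice_apply, map_sum] using this.symm

lemma range_slice_eq :
    LinearMap.range (slice (k := k) a b) = LinearMap.range (slice (k := k) b a) := by
  have h1 : LinearMap.range (slice (k := k) a b) ≤ LinearMap.range (slice (k := k) b a) := by
    rintro _ ⟨p, rfl⟩
    exact ⟨_, (h.slice_eq_slice_comp_antipode p).symm⟩
  have h2 : LinearMap.range (slice (k := k) b a) =
      (LinearMap.range (slice (k := k) a b)).map (HopfAlgebra.antipode k) := by
    rw [← LinearMap.range_comp]
    congr 1
    exact LinearMap.ext h.slice_eq_antipode_slice
  refine Submodule.eq_of_le_of_finrank_le h1 ?_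
  rw [h2]
  exact Submodule.finrank_map_le _ _

/-- The subalgebra of left components of a triangular structure. -/
def sliceSubalgebra : Subalgebra k A :=
  (LinearMap.range (slice (k := k) a b)).toSubalgebra ⟨_, h.slice_counit⟩ (by
    rintro _ _ ⟨p, rfl⟩ ⟨q, rfl⟩
    exact ⟨_, (h.slice_mul_slice p q).symm⟩)

lemma isSubHopf_sliceSubalgebra : IsSubHopf k A h.sliceSubalgebra := by
  constructor
  · rintro _ ⟨p, rfl⟩
    refine mem_range_map_of_contractions (LinearMap.range (slice (k := k) a b))
      (LinearMap.range (slice (k := k) a b)) _ (fun q => ?_) fun q => ?_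
    · refine ⟨p ∘ₗ LinearMap.mulRight k (slice b a q), ?_⟩
      rw [h.comul_slice]
      simp [slice_apply, Finset.mul_sum, Finset.sum_smul, smul_smul, mul_comm]
    · refine ⟨p ∘ₗ LinearMap.mulLeft k (slice b a q), ?_⟩
      rw [h.comul_slice, Finset.sum_comm]
      simp [slice_apply, Finset.sum_mul, Finset.sum_smul, smul_smul, mul_comm]
  · rintro _ ⟨p, rfl⟩
    rw [← h.slice_eq_antipode_slice]
    change _ ∈ LinearMap.range (slice (k := k) a b)
    rw [h.range_slice_eq]
    exact ⟨p, rfl⟩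

lemma memTensorSquare_sliceSubalgebra :
    MemTensorSquare k A h.sliceSubalgebra.toSubmodule (∑ i, a i ⊗ₜ[k] b i) := by
  refine mem_range_map_of_contractions (LinearMap.range (slice (k := k) a b))
    (LinearMap.range (slice (k := k) a b)) _ (fun q => ?_) fun q => ?_
  · exact ⟨q, by simp [slice_apply, map_sum]⟩
  · rw [h.range_slice_eq]
    exact ⟨q, by simp [slice_apply, map_sum]⟩

end IsTriangularFamily

end Family

section Pairing

/-- In a finite-dimensional algebra over an algebraically closed field, an element killed by every
surjection onto a matrix algebra is nilpotent. -/
lemma isNilpotent_of_forall_matrix {k : Type u} [Field k] [IsAlgClosed k] {A : Type v} [Ring A]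
    [Algebra k A] [FiniteDimensional k A] (x : A)
    (hx : ∀ (n : ℕ) [NeZero n] (φ : A →ₐ[k] Matrix (Fin n) (Fin n) k),
      Function.Surjective φ → φ x = 0) : IsNilpotent x := by
  have : IsArtinianRing A := IsArtinianRing.of_finite k A
  have : IsSemisimpleRing (A ⧸ Ring.jacobson A) := IsSemiprimaryRing.isSemisimpleRing
  obtain ⟨n, d, hd, ⟨e⟩⟩ :=
    IsSemisimpleRing.exists_algEquiv_pi_matrix_of_isAlgClosed (F := k) (R := A ⧸ Ring.jacobson A)
  have hmem : x ∈ Ring.jacobson A := by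
    rw [← Ideal.Quotient.eq_zero_iff_mem]
    apply e.injective
    rw [map_zero]
    funext i
    have := hd i
    let φ : A →ₐ[k] Matrix (Fin (d i)) (Fin (d i)) k :=
      ((Pi.evalAlgHom k _ i).comp e.toAlgHom).comp (Ideal.Quotient.mkₐ k (Ring.jacobson A))
    exact hx (d i) φ ((Function.surjective_eval i).comp
      (e.surjective.comp Ideal.Quotient.mk_surjective))
  obtain ⟨m, hm⟩ := IsSemiprimaryRing.isNilpotent (R := A)
  refine ⟨m, ?_⟩
  have := Ideal.pow_mem_pow hmem m
  rwa [hm] at this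

variable {k : Type u} [Field k] {A : Type v} [Ring A] [HopfAlgebra k A]

lemma apply_mul'_map {M N : Type*} [AddCommGroup M] [Module k M] [AddCommGroup N] [Module k N]
    (p : Module.Dual k M) (q : Module.Dual k N) (t : M ⊗[k] N) :
    LinearMap.mul' k k (TensorProduct.map p q t) = p (TensorProduct.rid k M (q.lTensor M t)) := by
  induction t with
  | zero => simp
  | tmul x y => simp [mul_comm]
  | add x y hx hy => simp [hx, hy]

lemma apply_mul'_map' {M N : Type*} [AddCommGroup M] [Module k M] [AddCommGroup N] [Module k N]
    (p : Module.Dual k M) (q : Module.Dual k N) (t : M ⊗[k] N) :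
    LinearMap.mul' k k (TensorProduct.map p q t) = q (TensorProduct.lid k N (p.rTensor N t)) := by
  induction t with
  | zero => simp
  | tmul x y => simp
  | add x y hx hy => simp [hx, hy]

/-- A one-dimensional subcoalgebra is spanned by a grouplike element. -/
lemma exists_isGrouplike_of_finrank_eq_one {C : Submodule k A}
    (hC : IsSubcoalgebraOf k (Coalgebra.comul (R := k)) C) (h1 : Module.finrank k C = 1) :
    ∃ g, IsGrouplike k A g ∧ C = Submodule.span k {g} := by
  obtain ⟨⟨c, hc⟩, hc0, hspan⟩ := finrank_eq_one_iff'.mp h1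
  have hspan' : ∀ x ∈ C, ∃ r : k, r • c = x := fun x hx => by
    obtain ⟨r, hr⟩ := hspan ⟨x, hx⟩
    exact ⟨r, congrArg Subtype.val hr⟩
  have hc0' : c ≠ 0 := fun h => hc0 (Subtype.ext h)
  obtain ⟨r, hr⟩ : ∃ r : k, Coalgebra.comul (R := k) c = r • c ⊗ₜ[k] c := by
    obtain ⟨y, hy⟩ := hC c hc
    rw [← hy]
    clear hy
    induction y with
    | zero => exact ⟨0, by simp⟩
    | tmul x y =>
      obtain ⟨s, hs⟩ := hspan' x x.2
      obtain ⟨t, ht⟩ := hspan' y y.2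
      refine ⟨s * t, ?_⟩
      simp only [TensorProduct.map_tmul, Submodule.subtype_apply, ← hs, ← ht]
      rw [TensorProduct.smul_tmul_smul]
    | add x y hx hy =>
      obtain ⟨s, hs⟩ := hx
      obtain ⟨t, ht⟩ := hy
      exact ⟨s + t, by rw [map_add, hs, ht, add_smul]⟩
  have hcounit : r * Coalgebra.counit (R := k) c = 1 := by
    have := congrArg (TensorProduct.lid k A) (Coalgebra.rTensor_counit_comul (R := k) c)
    rw [hr] at this
    simp only [map_smul, LinearMap.rTensor_tmul, TensorProduct.lid_tmul, one_smul,
      smul_smul] at this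
    exact smul_left_injective k hc0' (by simpa using this)
  have hr0 : r ≠ 0 := left_ne_zero_of_mul_eq_one hcounit
  refine ⟨r • c, ⟨by simpa using hcounit, ?_⟩, ?_⟩
  · rw [map_smul, hr, TensorProduct.smul_tmul_smul, smul_smul]
  · apply le_antisymm
    · intro x hx
      obtain ⟨s, rfl⟩ := hspan' x hx
      refine Submodule.mem_span_singleton.mpr ⟨s * r⁻¹, ?_⟩
      rw [smul_smul, mul_assoc, inv_mul_cancel₀ hr0, mul_one]
    · rw [Submodule.span_singleton_le_iff_mem]
      exact C.smul_mem _ hc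

/-- If a finite-dimensional pointed Hopf algebra is in perfect duality with itself so that the
product is dual to the coproduct, then an element orthogonal to all grouplike elements is
nilpotent. -/
lemma isNilpotent_of_pairing [IsAlgClosed k] [FiniteDimensional k A]
    (hpointed : IsPointed k A) (B : A ≃ₗ[k] Module.Dual k A)
    (hB_mul : ∀ x y c, B (x * y) c =
      LinearMap.mul' k k (TensorProduct.map (B x) (B y) (Coalgebra.comul (R := k) c)))
    (x : A) (hx : ∀ g, IsGrouplike k A g → B x g = 0) : IsNilpotent x := by
  have hflip_inj (c : A) (hc : ∀ y, B y c = 0) : c = 0 := by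
    rw [← Module.forall_dual_apply_eq_zero_iff k]
    intro p
    simpa using hc (B.symm p)
  have hflip_surj (p : Module.Dual k A) : ∃ c, ∀ y, B y c = p y := by
    have hinj : Function.Injective B.toLinearMap.flip := by
      rw [injective_iff_map_eq_zero]
      intro c hc
      exact hflip_inj c fun y => by simpa using LinearMap.congr_fun hc y
    obtain ⟨c, hc⟩ := (LinearMap.injective_iff_surjective_of_finrank_eq_finrank
      Subspace.dual_finrank_eq.symm).mp hinj p
    exact ⟨c, fun y => by simpa using LinearMap.congr_fun hc y⟩
  refine isNilpotent_of_forall_matrix (k := k) x fun n _ φ hφ => ?_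
  let C : Submodule k A :=
    { carrier := {c | ∀ y, φ y = 0 → B y c = 0}
      add_mem' := fun hc hd y hy => by rw [map_add, hc y hy, hd y hy, add_zero]
      zero_mem' := fun y _ => map_zero _
      smul_mem' := fun r c hc y hy => by rw [map_smul, hc y hy, smul_zero] }
  have hdouble (y : A) (hy : ∀ c ∈ C, B y c = 0) : φ y = 0 := by
    by_contra hne
    obtain ⟨p, hp, hle⟩ := Submodule.exists_le_ker_of_notMem
      (p := LinearMap.ker φ.toLinearMap) (v := y) hne
    obtain ⟨c, hc⟩ := hflip_surj p
    refine hp ?_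
    rw [← hc]
    exact hy c fun z hz => by rw [hc]; exact hle hz
  have hCsub : IsSubcoalgebraOf k (Coalgebra.comul (R := k)) C := by
    intro c hc
    refine mem_range_map_of_contractions C C _ (fun p y hy => ?_) fun p y hy => ?_
    · rw [← B.apply_symm_apply p, ← apply_mul'_map, ← hB_mul]
      exact hc _ (by rw [map_mul, hy, zero_mul])
    · rw [← B.apply_symm_apply p, ← apply_mul'_map', ← hB_mul]
      exact hc _ (by rw [map_mul, hy, mul_zero])
  have hCne : C ≠ ⊥ := by
    intro hbot
    have h1 := hdouble 1 fun c hc => by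
      rw [hbot, Submodule.mem_bot] at hc
      rw [hc, map_zero]
    rw [map_one] at h1
    exact one_ne_zero h1
  have hCsimple : IsSimpleSubcoalgebraOf k (Coalgebra.comul (R := k)) C := by
    refine ⟨hCne, hCsub, fun D hD hle => ?_⟩
    let I : TwoSidedIdeal (Matrix (Fin n) (Fin n) k) := TwoSidedIdeal.mk'
      {m | ∃ y, φ y = m ∧ ∀ d ∈ D, B y d = 0}
      ⟨0, map_zero _, fun d _ => by simp⟩
      (by
        rintro _ _ ⟨y, rfl, hy⟩ ⟨z, rfl, hz⟩
        exact ⟨y + z, map_add _ _ _, fun d hd => by simp [hy d hd, hz d hd]⟩)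
      (by
        rintro _ ⟨y, rfl, hy⟩
        exact ⟨-y, map_neg _ _, fun d hd => by simp [hy d hd]⟩)
      (by
        rintro m _ ⟨y, rfl, hy⟩
        obtain ⟨z, rfl⟩ := hφ m
        refine ⟨z * y, map_mul _ _ _, fun d hd => ?_⟩
        rw [hB_mul, apply_mul'_map']
        exact hy _ (lid_rTensor_mem (hD d hd) _))
      (by
        rintro _ m ⟨y, rfl, hy⟩
        obtain ⟨z, rfl⟩ := hφ m
        refine ⟨y * z, map_mul _ _ _, fun d hd => ?_⟩
        rw [hB_mul, apply_mul'_map]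
        exact hy _ (rid_lTensor_mem (hD d hd) _))
    have hI (m) : m ∈ I ↔ ∃ y, φ y = m ∧ ∀ d ∈ D, B y d = 0 := by
      rw [TwoSidedIdeal.mem_mk']
      rfl
    rcases eq_bot_or_eq_top I with hbot | htop
    · right
      refine le_antisymm hle fun c hc => ?_
      by_contra hne
      obtain ⟨p, hp, hker⟩ := Submodule.exists_le_ker_of_notMem hne
      refine hp ?_
      have : φ (B.symm p) ∈ I := (hI _).mpr ⟨_, rfl, fun d hd => by simpa using hker hd⟩
      rw [hbot, TwoSidedIdeal.mem_bot] at this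
      simpa using hc _ this
    · left
      rw [eq_bot_iff]
      intro d hd
      rw [Submodule.mem_bot]
      refine hflip_inj d fun y => ?_
      obtain ⟨z, hz, hzD⟩ := (hI (φ y)).mp (by rw [htop]; trivial)
      have := hle hd (y - z) (by rw [map_sub, hz, sub_self])
      rwa [map_sub, LinearMap.sub_apply, hzD d hd, sub_zero] at this
  obtain ⟨g, hg, hCg⟩ := exists_isGrouplike_of_finrank_eq_one hCsub (hpointed C hCsimple)
  refine hdouble x fun c hc => ?_
  rw [hCg, Submodule.mem_span_singleton] at hc
  obtain ⟨r, rfl⟩ := hc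
  rw [map_smul, hx g hg, smul_zero]

end Pairing

section GroupAlgebra

/-- The coefficient at `1` of a nilpotent element of a group algebra vanishes in characteristic
zero. -/
lemma coeff_one_eq_zero_of_isNilpotent {k : Type*} [Field k] [CharZero k] {G : Type*} [Group G]
    [Finite G] {x : MonoidAlgebra k G} (hx : IsNilpotent x) : x.coeff 1 = 0 := by
  classical
  have := Fintype.ofFinite G
  have hL : IsNilpotent (LinearMap.mulLeft k x) := by
    obtain ⟨n, hn⟩ := hx
    exact ⟨n, by rw [LinearMap.pow_mulLeft, hn, LinearMap.mulLeft_zero_eq_zero]⟩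
  have htr := (LinearMap.isNilpotent_trace_of_isNilpotent hL).eq_zero
  rw [LinearMap.trace_eq_matrix_trace k (MonoidAlgebra.basis G k), Matrix.trace] at htr
  simpa [Algebra.leftMulMatrix_eq_repr_mul, MonoidAlgebra.basis] using htr

/-- An element of a group algebra in characteristic zero vanishes if all its right multiples are
nilpotent. -/
lemma eq_zero_of_forall_isNilpotent_mul {k : Type*} [Field k] [CharZero k] {G : Type*} [Group G]
    [Finite G] {x : MonoidAlgebra k G} (hx : ∀ y, IsNilpotent (x * y)) : x = 0 := by
  ext g
  simpa using coeff_one_eq_zero_of_isNilpotent (hx (MonoidAlgebra.single g⁻¹ 1))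

end GroupAlgebra

section Projection

variable {k : Type u} [Field k] {A : Type v} [Ring A] [HopfAlgebra k A]

lemma isGrouplike_iff {g : A} : IsGrouplike k A g ↔ IsGroupLikeElem k g :=
  ⟨fun h => ⟨h.1, h.2⟩, fun h => ⟨h.counit_eq_one, h.comul_eq_tmul_self⟩⟩

lemma IsGrouplike.antipode_antipode {g : A} (hg : IsGrouplike k A g) :
    HopfAlgebra.antipode k (HopfAlgebra.antipode k g) = g :=
  (isGrouplike_iff.mp hg).antipode_antipode

variable (k A) in
/-- The group algebra of the grouplike elements, mapped to the Hopf algebra. -/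
def groupAlgebraMap : MonoidAlgebra k (GroupLike k A) →ₐ[k] A :=
  MonoidAlgebra.lift k A (GroupLike k A) (GroupLike.valMonoidHom k A)

@[simp]
lemma groupAlgebraMap_single (g : GroupLike k A) (r : k) :
    groupAlgebraMap k A (MonoidAlgebra.single g r) = r • g.val :=
  MonoidAlgebra.lift_single _ _ _

lemma groupAlgebraMap_injective : Function.Injective (groupAlgebraMap k A) := by
  rw [injective_iff_map_eq_zero]
  intro x hx
  have hlin := linearIndep_groupLikeVal (R := k) (A := A)
  rw [linearIndependent_iff] at hlin
  rw [← MonoidAlgebra.coeff_eq_zero]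
  refine hlin _ ?_
  rw [← hx]
  simp [groupAlgebraMap, MonoidAlgebra.lift_apply, Finsupp.linearCombination_apply]

lemma range_groupAlgebraMap : LinearMap.range (groupAlgebraMap k A).toLinearMap =
    Submodule.span k {g : A | IsGrouplike k A g} := by
  apply le_antisymm
  · rintro _ ⟨x, rfl⟩
    simp only [groupAlgebraMap, AlgHom.toLinearMap_apply, MonoidAlgebra.lift_apply]
    exact Submodule.sum_mem _ fun g _ => Submodule.smul_mem _ _
      (Submodule.subset_span (isGrouplike_iff.mpr g.2))
  · rw [Submodule.span_le]
    intro g hg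
    exact ⟨MonoidAlgebra.single ⟨g, isGrouplike_iff.mp hg⟩ 1, by simp⟩

/-- A perfect self-pairing of a Hopf algebra for which the product is dual to the coproduct in the
left argument, and dual to the opposite coproduct in the right argument. -/
structure IsHopfPairing (B : A ≃ₗ[k] Module.Dual k A) : Prop where
  one_left (c : A) : B 1 c = Coalgebra.counit (R := k) c
  mul_left (x y c : A) : B (x * y) c =
    LinearMap.mul' k k (TensorProduct.map (B x) (B y) (Coalgebra.comul (R := k) c))
  mul_right (x c d : A) : B x (d * c) = LinearMap.mul' k k
    (TensorProduct.map (B.toLinearMap.flip c) (B.toLinearMap.flip d) (Coalgebra.comul (R := k) x))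

namespace IsHopfPairing

variable {B : A ≃ₗ[k] Module.Dual k A} (hB : IsHopfPairing B)

/-- The algebra map given by pairing with all grouplike elements. -/
def evalHom : A →ₐ[k] (GroupLike k A → k) :=
  AlgHom.ofLinearMap (LinearMap.pi fun g => B.toLinearMap.flip g.val)
    (by ext g; simpa [g.2.counit_eq_one] using hB.one_left g.val)
    (fun x y => by
      ext g
      simp [hB.mul_left, g.2.comul_eq_tmul_self])

include hB

lemma evalHom_groupAlgebraMap_bijective [IsAlgClosed k] [CharZero k] [FiniteDimensional k A]
    (hpointed : IsPointed k A) :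
    Function.Bijective (hB.evalHom.comp (groupAlgebraMap k A)) := by
  have hfin : Finite (GroupLike k A) :=
    (linearIndep_groupLikeVal (R := k) (A := A)).finite
  have hinj : Function.Injective (hB.evalHom.comp (groupAlgebraMap k A)) := by
    rw [injective_iff_map_eq_zero]
    intro x hx
    refine eq_zero_of_forall_isNilpotent_mul fun y => ?_
    rw [← IsNilpotent.map_iff (f := groupAlgebraMap k A) groupAlgebraMap_injective]
    refine isNilpotent_of_pairing hpointed B hB.mul_left _ fun g hg => ?_
    have h0 : (hB.evalHom.comp (groupAlgebraMap k A)) (x * y) = 0 := by rw [map_mul, hx, zero_mul]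
    exact congrFun h0 ⟨g, isGrouplike_iff.mp hg⟩
  refine ⟨hinj, ?_⟩
  have := Fintype.ofFinite (GroupLike k A)
  refine (LinearMap.injective_iff_surjective_of_finrank_eq_finrank
    (f := (hB.evalHom.comp (groupAlgebraMap k A)).toLinearMap) ?_).mp hinj
  rw [Module.finrank_eq_card_basis (MonoidAlgebra.basis (GroupLike k A) k),
    Module.finrank_fintype_fun_eq_card]

/-- Elements of the span of the grouplikes are separated by pairing with grouplikes. -/
lemma eq_of_forall_grouplike [IsAlgClosed k] [CharZero k] [FiniteDimensional k A]
    (hpointed : IsPointed k A) {x y : A}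
    (hx : x ∈ Submodule.span k {g : A | IsGrouplike k A g})
    (hy : y ∈ Submodule.span k {g : A | IsGrouplike k A g})
    (hxy : ∀ g, IsGrouplike k A g → B x g = B y g) : x = y := by
  rw [← range_groupAlgebraMap] at hx hy
  obtain ⟨x, rfl⟩ := hx
  obtain ⟨y, rfl⟩ := hy
  refine congrArg (groupAlgebraMap k A)
    ((hB.evalHom_groupAlgebraMap_bijective hpointed).injective ?_)
  ext g
  exact hxy g.val (isGrouplike_iff.mpr g.2)

/-- A pointed self-dual Hopf algebra projects onto the span of its grouplikes. -/
lemma exists_algHom_span_grouplike [IsAlgClosed k] [CharZero k] [FiniteDimensional k A]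
    (hpointed : IsPointed k A) : ∃ π : A →ₐ[k] A,
      (∀ x, π x ∈ Submodule.span k {g : A | IsGrouplike k A g}) ∧
      (∀ x ∈ Submodule.span k {g : A | IsGrouplike k A g}, π x = x) ∧
      (∀ x g, IsGrouplike k A g → B (π x) g = B x g) := by
  let e := AlgEquiv.ofBijective _ (hB.evalHom_groupAlgebraMap_bijective hpointed)
  let π : A →ₐ[k] A := (groupAlgebraMap k A).comp (e.symm.toAlgHom.comp hB.evalHom)
  have h1 (x) : π x ∈ Submodule.span k {g : A | IsGrouplike k A g} := by
    rw [← range_groupAlgebraMap]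
    exact ⟨_, rfl⟩
  have h3 (x g) (hg : IsGrouplike k A g) : B (π x) g = B x g :=
    congrFun (e.apply_symm_apply (hB.evalHom x)) ⟨g, isGrouplike_iff.mp hg⟩
  exact ⟨π, h1, fun x hx => hB.eq_of_forall_grouplike hpointed (h1 x) hx (h3 x), h3⟩

end IsHopfPairing

lemma IsGrouplike.mul {g h : A} (hg : IsGrouplike k A g) (hh : IsGrouplike k A h) :
    IsGrouplike k A (g * h) :=
  isGrouplike_iff.mpr ((isGrouplike_iff.mp hg).mul (isGrouplike_iff.mp hh))

lemma comul_mem_span_grouplike {x : A} (hx : x ∈ Submodule.span k {g : A | IsGrouplike k A g}) :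
    MemTensorSquare k A (Submodule.span k {g : A | IsGrouplike k A g})
      (Coalgebra.comul (R := k) x) := by
  let K := Submodule.span k {g : A | IsGrouplike k A g}
  change x ∈ (LinearMap.range (TensorProduct.map K.subtype K.subtype)).comap
    (Coalgebra.comul (R := k))
  revert x
  change K ≤ _
  rw [Submodule.span_le]
  intro g hg
  let g' : K := ⟨g, Submodule.subset_span hg⟩
  exact ⟨g' ⊗ₜ g', by simpa [g'] using hg.2.symm⟩

lemma map_mem_tensorSquare {V : Submodule k A} {f : A →ₗ[k] A} (hf : ∀ x, f x ∈ V)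
    (t : A ⊗[k] A) : MemTensorSquare k A V (TensorProduct.map f f t) := by
  refine ⟨TensorProduct.map (f.codRestrict V hf) (f.codRestrict V hf) t, ?_⟩
  rw [← LinearMap.comp_apply, ← TensorProduct.map_comp]
  rfl

lemma map_eq_self_of_mem_tensorSquare {V : Submodule k A} {f : A →ₗ[k] A} (hf : ∀ x ∈ V, f x = x)
    {t : A ⊗[k] A} (ht : MemTensorSquare k A V t) : TensorProduct.map f f t = t := by
  obtain ⟨s, rfl⟩ := ht
  rw [← LinearMap.comp_apply, ← TensorProduct.map_comp]
  congr 2 <;> exact LinearMap.ext fun x => hf x x.2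

lemma IsHopfPairing.eq_of_forall_grouplike_tmul [IsAlgClosed k] [CharZero k]
    [FiniteDimensional k A] {B : A ≃ₗ[k] Module.Dual k A} (hB : IsHopfPairing B)
    (hpointed : IsPointed k A) {s t : A ⊗[k] A}
    (hs : MemTensorSquare k A (Submodule.span k {g : A | IsGrouplike k A g}) s)
    (ht : MemTensorSquare k A (Submodule.span k {g : A | IsGrouplike k A g}) t)
    (hst : ∀ g h, IsGrouplike k A g → IsGrouplike k A h →
      LinearMap.mul' k k (TensorProduct.map (B.toLinearMap.flip g) (B.toLinearMap.flip h) s) =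
        LinearMap.mul' k k (TensorProduct.map (B.toLinearMap.flip g) (B.toLinearMap.flip h) t)) :
    s = t := by
  have hright (g) (hg : IsGrouplike k A g) :
      TensorProduct.lid k A ((B.toLinearMap.flip g).rTensor A s) =
        TensorProduct.lid k A ((B.toLinearMap.flip g).rTensor A t) := by
    refine hB.eq_of_forall_grouplike hpointed (lid_rTensor_mem hs _) (lid_rTensor_mem ht _)
      fun h hh => ?_
    have := hst g h hg hh
    rwa [apply_mul'_map', apply_mul'_map'] at this
  refine tensor_ext_right fun p => hB.eq_of_forall_grouplike hpointed
    (rid_lTensor_mem hs _) (rid_lTensor_mem ht _) fun g hg => ?_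
  have := congrArg p (hright g hg)
  rwa [← apply_mul'_map', ← apply_mul'_map', apply_mul'_map, apply_mul'_map] at this

lemma IsHopfPairing.comul_algHom [IsAlgClosed k] [CharZero k]
    [FiniteDimensional k A] {B : A ≃ₗ[k] Module.Dual k A} (hB : IsHopfPairing B)
    (hpointed : IsPointed k A) {π : A →ₐ[k] A}
    (hπ : ∀ x, π x ∈ Submodule.span k {g : A | IsGrouplike k A g})
    (hπB : ∀ x g, IsGrouplike k A g → B (π x) g = B x g) (x : A) :
    Coalgebra.comul (R := k) (π x) =
      TensorProduct.map π.toLinearMap π.toLinearMap (Coalgebra.comul (R := k) x) := by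
  refine hB.eq_of_forall_grouplike_tmul hpointed (comul_mem_span_grouplike (hπ x))
    (map_mem_tensorSquare hπ _) fun g h hg hh => ?_
  have hflip (g) (hg : IsGrouplike k A g) :
      B.toLinearMap.flip g ∘ₗ π.toLinearMap = B.toLinearMap.flip g :=
    LinearMap.ext fun x => hπB x g hg
  rw [← hB.mul_right, hπB _ _ (hh.mul hg), hB.mul_right, TensorProduct.map_map,
    hflip g hg, hflip h hh]

end Projection

section Structure

variable {k : Type u} [Field k] {A : Type v} [Ring A] [HopfAlgebra k A] {ι : Type*} [Fintype ι]

lemma slice_flip {a b : ι → A} {B : A ≃ₗ[k] Module.Dual k A} (hB : ∀ p, B (slice b a p) = p)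
    (c : A) : slice a b (B.toLinearMap.flip c) = c := by
  rw [← sub_eq_zero, ← Module.forall_dual_apply_eq_zero_iff k]
  intro q
  rw [map_sub, apply_slice, LinearMap.flip_apply, LinearEquiv.coe_coe, hB, sub_self]

namespace IsTriangularFamily

variable {a b : ι → A} (h : IsTriangularFamily k a b)
include h

/-- A minimal triangular structure identifies the Hopf algebra with its dual. -/
lemma exists_isHopfPairing [FiniteDimensional k A] (hs : Function.Surjective (slice (k := k) a b)) :
    ∃ B : A ≃ₗ[k] Module.Dual k A, IsHopfPairing B ∧ ∀ p, B (slice b a p) = p := by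
  have hs' : Function.Surjective (slice (k := k) b a) := by
    rw [← LinearMap.range_eq_top, ← h.range_slice_eq, LinearMap.range_eq_top]
    exact hs
  have hi' : Function.Injective (slice (k := k) b a) :=
    (LinearMap.injective_iff_surjective_of_finrank_eq_finrank Subspace.dual_finrank_eq).mpr hs'
  let F : Module.Dual k A ≃ₗ[k] A := LinearEquiv.ofBijective (slice b a) ⟨hi', hs'⟩
  have hF (p) : F.symm (slice b a p) = p := F.symm_apply_apply p
  refine ⟨F.symm, ⟨fun c => ?_, fun x y c => ?_, fun x c d => ?_⟩, hF⟩
  · rw [← h.slice_counit', hF]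
  · obtain ⟨p, rfl⟩ := hs' x
    obtain ⟨q, rfl⟩ := hs' y
    rw [h.slice_mul_slice', hF, hF, hF]
    rfl
  · obtain ⟨p, rfl⟩ := hs' x
    conv_lhs => rw [← slice_flip hF c, ← slice_flip hF d]
    rw [hF, h.comul_slice']
    simp only [slice_apply, Finset.sum_mul_sum, map_sum, map_smul, TensorProduct.map_tmul,
      LinearMap.mul'_apply, smul_eq_mul, smul_mul_smul_comm]
    refine Finset.sum_congr rfl fun i _ => Finset.sum_congr rfl fun j _ => ?_
    ring

lemma comul_antipode (hs : Function.Surjective (slice (k := k) a b)) (x : A) :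
    Coalgebra.comul (R := k) (HopfAlgebra.antipode k x) =
      TensorProduct.comm k A A (TensorProduct.map (HopfAlgebra.antipode k)
        (HopfAlgebra.antipode k) (Coalgebra.comul (R := k) x)) := by
  obtain ⟨p, rfl⟩ := hs x
  have := congrArg (TensorProduct.rid k (A ⊗[k] A) ∘ p.lTensor (A ⊗[k] A)) h.comul_antipode_tmul
  simpa [slice_apply, map_sum] using this

/-- The Drinfeld element of a minimal triangular structure is grouplike. -/
lemma isGrouplike_drinfeldOf
    (hint : ∀ x : A, TensorProduct.comm k A A (Coalgebra.comul (R := k) x) *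
      (∑ i, a i ⊗ₜ[k] b i) = (∑ i, a i ⊗ₜ[k] b i) * Coalgebra.comul (R := k) x)
    (hs : Function.Surjective (slice (k := k) a b)) :
    IsGrouplike k A (drinfeldOf k A (∑ i, a i ⊗ₜ[k] b i)) := by
  have hu : drinfeldOf k A (∑ i, a i ⊗ₜ[k] b i) = ∑ i, HopfAlgebra.antipode k (b i) * a i := by
    simp [drinfeldOf, map_sum]
  rw [hu]
  refine ⟨?_, h.comul_drinfeld hint (h.comul_antipode hs)⟩
  have := congrArg (Coalgebra.counit (R := k)) h.sum_counit_smul_left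
  simpa [map_sum] using this

/-- The image of a triangular structure under an algebra map commuting with the coproduct. -/
lemma map {π : A →ₐ[k] A} (hπ : ∀ x, Coalgebra.comul (R := k) (π x) =
      TensorProduct.map π.toLinearMap π.toLinearMap (Coalgebra.comul (R := k) x)) :
    IsTriangularFamily k (fun i => π (a i)) (fun i => π (b i)) where
  comul_left := by
    have := congrArg (TensorProduct.map (TensorProduct.map π.toLinearMap π.toLinearMap)
      π.toLinearMap) h.comul_left
    simpa [map_sum, hπ] using this
  comul_right := by
    have := congrArg (TensorProduct.map π.toLinearMap
      (TensorProduct.map π.toLinearMap π.toLinearMap)) h.comul_right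
    simpa [map_sum, hπ] using this
  mul_swap := by
    have := congrArg (Algebra.TensorProduct.map π π) h.mul_swap
    simpa [map_sum] using this

end IsTriangularFamily

lemma IsHopfPairing.apply_mul {B : A ≃ₗ[k] Module.Dual k A} (hB : IsHopfPairing B) {g : A}
    (hg : IsGrouplike k A g) (x y : A) : B (x * y) g = B x g * B y g := by
  simp [hB.mul_left, hg.2]

lemma IsHopfPairing.apply_sum_mul {a b : ι → A} {B : A ≃ₗ[k] Module.Dual k A}
    (hB : IsHopfPairing B) (hBs : ∀ p, B (slice b a p) = p) {f : A →ₗ[k] A} {g : A}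
    (hg : IsGrouplike k A g) : B (∑ i, f (a i) * b i) g = B (f g) g := by
  conv_rhs => enter [1]; rw [← slice_flip hBs g, slice_apply]
  simp [map_sum, hB.apply_mul hg, mul_comm]

lemma IsHopfPairing.apply_self_mul_apply_self {a b : ι → A} (h : IsTriangularFamily k a b)
    {B : A ≃ₗ[k] Module.Dual k A} (hB : IsHopfPairing B) (hBs : ∀ p, B (slice b a p) = p) {g : A}
    (hg : IsGrouplike k A g) : B g g * B g g = 1 := by
  have h1 := congrArg (LinearMap.mul' k k ∘ TensorProduct.map (B.toLinearMap.flip g)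
    (B.toLinearMap.flip g)) h.mul_swap
  have h2 := hB.apply_sum_mul hBs (f := LinearMap.id) hg
  simp only [LinearMap.id_apply, map_sum, LinearMap.sum_apply, hB.apply_mul hg] at h2
  rw [← h2, Finset.sum_mul_sum]
  simp only [Function.comp_apply, map_sum, TensorProduct.map_tmul, LinearMap.mul'_apply,
    LinearMap.flip_apply, LinearEquiv.coe_coe, hB.apply_mul hg, Algebra.TensorProduct.one_def,
    hB.one_left, hg.1, mul_one] at h1
  rw [← h1]
  refine Finset.sum_congr rfl fun i _ => Finset.sum_congr rfl fun j _ => ?_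
  ring

end Structure

/-- Let `(A,R)` be a minimal triangular pointed Hopf algebra with
Drinfeld element `u` over an algebraically closed field `k` of characteristic `0`, and set
`K := k[G(A)]` (the span of the grouplike elements of `A`). Then `K` admits a minimal
triangular structure whose Drinfeld element equals `u`; in particular `u ∈ K` and
`u² = 1`. -/
theorem group_algebra_admits_minimal_triangular_structure
    (k : Type u) [Field k] [IsAlgClosed k] [CharZero k]
    (A : Type v) [Ring A] [HopfAlgebra k A]
    (Q : QuasiTriangular k A) (htri : Q.IsTriangular) (hmin : Q.IsMinimal)
    (hpointed : IsPointed k A) :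
    (∃ r : A ⊗[k] A,
      MemTensorSquare k A (Submodule.span k {g : A | IsGrouplike k A g}) r ∧
      IsUnit r ∧
      (∀ a ∈ Submodule.span k {g : A | IsGrouplike k A g},
        (TensorProduct.comm k A A) (Coalgebra.comul (R := k) a) * r =
          r * Coalgebra.comul (R := k) a) ∧
      Hexagon₁ k A r ∧ Hexagon₂ k A r ∧
      r * (TensorProduct.comm k A A) r = 1 ∧
      (∀ B : Subalgebra k A, IsSubHopf k A B → MemTensorSquare k A B.toSubmodule r →
        Submodule.span k {g : A | IsGrouplike k A g} ≤ B.toSubmodule) ∧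
      drinfeldOf k A r = Q.drinfeld) ∧
    Q.drinfeld ∈ Submodule.span k {g : A | IsGrouplike k A g} ∧
    Q.drinfeld * Q.drinfeld = 1 := by
  obtain ⟨n, a, b, hR⟩ := TensorProduct.exists_sum_tmul_eq Q.R
  have h : IsTriangularFamily k a b := by
    rw [isTriangularFamily_iff, ← hR]
    exact ⟨Q.hexagon₁, Q.hexagon₂, htri⟩
  have hint := Q.intertwine
  rw [hR] at hint
  have hs : Function.Surjective (slice (k := k) a b) := by
    have htop := hmin h.sliceSubalgebra h.isSubHopf_sliceSubalgebra
      (hR ▸ h.memTensorSquare_sliceSubalgebra)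
    intro x
    have hx : x ∈ h.sliceSubalgebra := htop ▸ Algebra.mem_top
    exact hx
  have : FiniteDimensional k A := Module.Finite.of_surjective
    (LinearMap.range (slice (k := k) a b)).subtype fun x => ⟨⟨x, hs x⟩, rfl⟩
  obtain ⟨B, hB, hBs⟩ := h.exists_isHopfPairing hs
  obtain ⟨π, hπ, hπK, hπB⟩ := hB.exists_algHom_span_grouplike hpointed
  have hcomul := hB.comul_algHom hpointed hπ hπB
  have hr : TensorProduct.map π.toLinearMap π.toLinearMap Q.R = ∑ i, π (a i) ⊗ₜ[k] π (b i) := by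
    simp [hR, map_sum]
  have hr' : Algebra.TensorProduct.map π π Q.R = ∑ i, π (a i) ⊗ₜ[k] π (b i) := by
    simp [hR, map_sum]
  have hK := h.map hcomul
  obtain ⟨hK₁, hK₂, hK₃⟩ := (isTriangularFamily_iff _ _).mp hK
  have hu : IsGrouplike k A Q.drinfeld := by
    rw [QuasiTriangular.drinfeld, hR]
    exact h.isGrouplike_drinfeldOf hint hs
  have huB (g) (hg : IsGrouplike k A g) : B Q.drinfeld g = B g g := by
    have := hB.apply_sum_mul hBs (f := HopfAlgebra.antipode k ∘ₗ HopfAlgebra.antipode k) hg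
    rw [QuasiTriangular.drinfeld, hR, h.drinfeldOf_eq]
    simpa [hg.antipode_antipode] using this
  have hS (x) (hx : x ∈ Submodule.span k {g : A | IsGrouplike k A g}) :
      HopfAlgebra.antipode k (HopfAlgebra.antipode k x) = x := by
    induction hx using Submodule.span_induction with
    | mem g hg => exact hg.antipode_antipode
    | zero => simp
    | add x y _ _ hx hy => rw [map_add, map_add, hx, hy]
    | smul r x _ hx => rw [map_smul, map_smul, hx]
  refine ⟨⟨∑ i, π (a i) ⊗ₜ[k] π (b i), ?_, ?_, fun x hx => ?_, hK₁, hK₂, hK₃,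
    fun C _ hrC => ?_, ?_⟩, Submodule.subset_span hu, ?_⟩
  · rw [← hr]
    exact map_mem_tensorSquare hπ _
  · rw [← hr']
    exact Q.isUnit.map _
  · have := congrArg (Algebra.TensorProduct.map π π) (Q.intertwine x)
    rw [map_mul, map_mul, hr'] at this
    have hx' : Algebra.TensorProduct.map π π (Coalgebra.comul (R := k) x) =
        Coalgebra.comul (R := k) x :=
      map_eq_self_of_mem_tensorSquare hπK (comul_mem_span_grouplike hx)
    have hcomm (t : A ⊗[k] A) : Algebra.TensorProduct.map π π (TensorProduct.comm k A A t) =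
        TensorProduct.comm k A A (Algebra.TensorProduct.map π π t) :=
      TensorProduct.map_comm _ _ _
    rwa [hcomm, hx'] at this
  · rw [Submodule.span_le]
    intro g hg
    have hsum := congrArg π (slice_flip hBs g)
    rw [hπK g (Submodule.subset_span hg), slice_apply] at hsum
    rw [SetLike.mem_coe, ← hsum]
    simpa [map_sum, hπB _ g hg] using rid_lTensor_mem hrC (B.toLinearMap.flip g)
  · have hsum : drinfeldOf k A (∑ i, π (a i) ⊗ₜ[k] π (b i)) = π (∑ i, a i * b i) := by
      rw [hK.drinfeldOf_eq, map_sum]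
      exact Finset.sum_congr rfl fun i _ => by rw [hS _ (hπ _), map_mul]
    rw [hsum]
    refine hB.eq_of_forall_grouplike hpointed (hπ _) (Submodule.subset_span hu) fun g hg => ?_
    rw [hπB _ g hg, huB g hg]
    exact hB.apply_sum_mul hBs (f := LinearMap.id) hg
  · refine hB.eq_of_forall_grouplike hpointed (Submodule.subset_span (hu.mul hu))
      (Submodule.subset_span (isGrouplike_iff.mpr .one)) fun g hg => ?_
    rw [hB.apply_mul hg, huB g hg, hB.one_left, hg.1]
    exact hB.apply_self_mul_apply_self h hBs hg

end Paper
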